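/- Deterministic core of Theorem 1.2 (non-hitting for α > 3): Let α > 3 and let ε ∈ (0, 1/2) satisfy (3−α)/2 + ε(α+1) < 0. Let Y, R, δ > 0 satisfy (π·Y^{−1−α}/2^{α+2})·R^{(3−α)/2+ε(α+1)} > 1 and δ < Y·R^{1/2−ε}. Let t₀ ≥ R, x₀ ∈ ℝ, and let u : [0,∞)×ℝ → ℝ and G : [0,∞)×ℝ → ℝ be measurable functions such that: (i) u(s,y) > 0 for all (s,y) ∈ [0,t₀]×ℝ; (ii) u(t₀,x₀) = δ; (iii) for every (t,x) in the closed sector S̄ = {(t,x) : |x₀−x| ≤ t₀−t and (t₀−t)²+(x₀−x)² ≤ R²}, the drift integral D(t,x) = ∫₀^t ∫_ℝ 1_{{|x−y|<t−s}} u(s,y)^{−α} dy ds is finite and u(t,x) = G(t,x) + D(t,x); (iv) |G(t,x) − G(t₀,x₀)| ≤ Y·((t₀−t)² + (x₀−x)²)^{(1/2−ε)/2} for all (t,x) ∈ S̄. Then a contradiction follows (i.e., no such pair (u,G) exists); equivalently, hypotheses (ii)–(iv) force u(t,x) < 0 at every point (t,x) of S̄ with (t₀−t)²+(x₀−x)²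 = R², contradicting (i). -/

import Mathlib

open MeasureTheory Real

lemma aux_tangent (α x : ℝ) (hα : 3 < α) (hx : 0 < x) (hx1 : x ≤ 1) :
    64 / 27 + 256 / 27 * (3 / 4 - x) ≤ x ^ (-α) := by
  have h1 : x ^ (-(3:ℝ)) ≤ x ^ (-α) :=
    Real.rpow_le_rpow_of_exponent_ge hx hx1 (by linarith)
  refine le_trans ?_ h1
  have h2 : x ^ (-(3:ℝ)) = 1 / x ^ 3 := by
    rw [Real.rpow_neg hx.le]
    norm_num
  rw [h2, le_div_iff₀ (by positivity)]
  nlinarith [mul_nonneg (sq_nonneg (4 * x - 3)) (by positivity : 0 ≤ 16 * x ^ 2 + 8 * x + 3)]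

lemma aux_vol0 (R : ℝ) (hR : 0 < R) :
    ENNReal.ofReal (π * R ^ 2 / 4) ≤
      volume {p : ℝ × ℝ | |p.2| < p.1 ∧ p.1 ^ 2 + p.2 ^ 2 ≤ R ^ 2} := by
  set S := {p : ℝ × ℝ | |p.2| < p.1 ∧ p.1 ^ 2 + p.2 ^ 2 ≤ R ^ 2} with hS
  have hSm : MeasurableSet S := by
    exact (measurableSet_lt (f := fun p : ℝ × ℝ => |p.2|) (g := fun p : ℝ × ℝ => p.1)
        (by fun_prop) (by fun_prop)).inter
      (measurableSet_le (f := fun p : ℝ × ℝ => p.1 ^ 2 + p.2 ^ 2) (g := fun _ => R ^ 2)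
        (by fun_prop) (by fun_prop))
  have h1 := lintegral_comp_polarCoord_symm (S.indicator (fun _ => (1 : ENNReal)))
  rw [lintegral_indicator_const hSm, one_mul] at h1
  rw [← h1]
  set B : Set (ℝ × ℝ) := Set.Ioo 0 R ×ˢ Set.Ioo (-(π / 4)) (π / 4) with hB
  have hBt : B ⊆ polarCoord.target := by
    rw [polarCoord_target]
    rintro ⟨r, θ⟩ ⟨⟨h1, h2⟩, h3, h4⟩
    have := Real.pi_pos
    exact ⟨h1, by simp at h3 ⊢; linarith, by simp at h4 ⊢; linarith⟩
  refine le_trans ?_ (lintegral_mono_set hBt)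
  have h2 : ∫⁻ p in B, ENNReal.ofReal p.1 ≤
      ∫⁻ p in B, ENNReal.ofReal p.1 • S.indicator (fun _ => (1 : ENNReal)) (polarCoord.symm p) := by
    apply setLIntegral_mono_ae' (measurableSet_Ioo.prod measurableSet_Ioo)
    refine Filter.Eventually.of_forall ?_
    rintro ⟨r, θ⟩ ⟨⟨h1, h2⟩, h3, h4⟩
    have hmem : polarCoord.symm (r, θ) ∈ S := by
      simp only [polarCoord_symm_apply, hS, Set.mem_ofPred_eq]
      simp only at h1 h2 h3 h4
      have hc : |sin θ| < cos θ := by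
        have hpi := Real.pi_pos
        have hcos : 0 < cos θ := Real.cos_pos_of_mem_Ioo ⟨by linarith, by linarith⟩
        have h2θ : 0 < cos (2 * θ) := Real.cos_pos_of_mem_Ioo ⟨by linarith, by linarith⟩
        rw [Real.cos_two_mul'] at h2θ
        exact abs_lt_of_sq_lt_sq (by linarith) hcos.le
      constructor
      · rw [abs_mul, abs_of_pos h1]
        exact mul_lt_mul_of_pos_left hc h1
      · have : (r * cos θ) ^ 2 + (r * sin θ) ^ 2 = r ^ 2 := by
          nlinarith [Real.sin_sq_add_cos_sq θ]
        rw [this]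
        exact pow_le_pow_left₀ h1.le h2.le 2
    rw [Set.indicator_of_mem hmem]
    simp
  refine le_trans (le_of_eq ?_) h2
  rw [← ofReal_integral_eq_lintegral_ofReal]
  · congr 1
    have := setIntegral_prod_mul (μ := (volume : Measure ℝ)) (ν := (volume : Measure ℝ))
      (fun x : ℝ => x) (fun _ : ℝ => (1:ℝ)) (Set.Ioo 0 R) (Set.Ioo (-(π / 4)) (π / 4))
    simp only [mul_one] at this
    rw [hB, Measure.volume_eq_prod, this, ← integral_Ioc_eq_integral_Ioo,
      ← intervalIntegral.integral_of_le hR.le, integral_id]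
    have := Real.pi_pos
    simp [measureReal_def, Real.volume_Ioo]
    rw [ENNReal.toReal_ofReal (by linarith)]
    ring
  · have : IntegrableOn (fun p : ℝ × ℝ => p.1) (Set.Icc 0 R ×ˢ Set.Icc (-(π / 4)) (π / 4)) :=
      ContinuousOn.integrableOn_compact (isCompact_Icc.prod isCompact_Icc) (by fun_prop)
    exact this.mono_set (Set.prod_mono Set.Ioo_subset_Icc_self Set.Ioo_subset_Icc_self)
  · refine (ae_restrict_iff' (measurableSet_Ioo.prod measurableSet_Ioo)).2
      (Filter.Eventually.of_forall ?_)
    rintro p ⟨⟨h1, h2⟩, h3⟩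
    exact h1.le

lemma aux_vol (R t₀ x₀ : ℝ) (hR : 0 < R) :
    ENNReal.ofReal (π * R ^ 2 / 4) ≤
      volume {p : ℝ × ℝ | |x₀ - p.2| < t₀ - p.1 ∧ (t₀ - p.1) ^ 2 + (x₀ - p.2) ^ 2 ≤ R ^ 2} := by
  have hmp := Measure.measurePreserving_sub_left (volume : Measure (ℝ × ℝ)) (t₀, x₀)
  refine (aux_vol0 R hR).trans (le_of_eq ?_)
  rw [← hmp.measure_preimage (MeasurableSet.nullMeasurableSet ?_)]
  · rfl
  · exact (measurableSet_lt (f := fun p : ℝ × ℝ => |p.2|) (g := fun p : ℝ × ℝ => p.1)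
        (by fun_prop) (by fun_prop)).inter
      (measurableSet_le (f := fun p : ℝ × ℝ => p.1 ^ 2 + p.2 ^ 2) (g := fun _ => R ^ 2)
        (by fun_prop) (by fun_prop))

lemma aux_double (μ : Measure (ℝ × ℝ)) [IsFiniteMeasure μ] (L : ℝ × ℝ → Set (ℝ × ℝ))
    (hT : MeasurableSet {z : (ℝ × ℝ) × (ℝ × ℝ) | z.2 ∉ L z.1})
    (hL : ∀ p q, q ∈ L p → p ∉ L q) :
    Integrable (fun p => μ.real (L p)ᶜ) μ ∧
    μ.real Set.univ ^ 2 / 2 ≤ ∫ p, μ.real (L p)ᶜ ∂μ := by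
  set T := {z : (ℝ × ℝ) × (ℝ × ℝ) | z.2 ∉ L z.1} with hTdef
  have hpre : ∀ p, Prod.mk p ⁻¹' T = (L p)ᶜ := fun p => rfl
  have hmeas : Measurable (fun p => μ (L p)ᶜ) := by
    have := measurable_measure_prodMk_left (ν := μ) hT
    simpa only [hpre] using this
  have hint : Integrable (fun p => μ.real (L p)ᶜ) μ := by
    refine Integrable.of_bound (C := μ.real Set.univ) hmeas.ennreal_toReal.aestronglyMeasurable ?_
    refine Filter.Eventually.of_forall fun p => ?_
    rw [Real.norm_of_nonneg measureReal_nonneg]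
    exact measureReal_mono (Set.subset_univ _)
  refine ⟨hint, ?_⟩
  have h1 : (μ.prod μ).real T = ∫ p, μ.real (L p)ᶜ ∂μ := by
    rw [measureReal_def, Measure.prod_apply hT]
    simp only [hpre]
    rw [← integral_toReal hmeas.aemeasurable
      (Filter.Eventually.of_forall fun p => measure_lt_top _ _)]
    rfl
  have h2 : (μ.prod μ).real (Prod.swap ⁻¹' T) = (μ.prod μ).real T := by
    rw [measureReal_def, (Measure.measurePreserving_swap (μ := μ) (ν := μ)).measure_preimage
      hT.nullMeasurableSet, measureReal_def]
  have h3 : (Set.univ : Set ((ℝ × ℝ) × (ℝ × ℝ))) ⊆ T ∪ Prod.swap ⁻¹' T := by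
    rintro ⟨p, q⟩ -
    by_cases h : q ∈ L p
    · right; exact hL p q h
    · left; exact h
  have h4 := measureReal_mono (μ := μ.prod μ) h3
  have h5 := measureReal_union_le (μ := μ.prod μ) T (Prod.swap ⁻¹' T)
  have h6 : (μ.prod μ).real Set.univ = μ.real Set.univ ^ 2 := by
    rw [← Set.univ_prod_univ, measureReal_prod_prod, sq]
  rw [← h1]
  linarith

/-- Deterministic core of Theorem 1.2 (non-hitting for `α > 3`): given the
Hölder bound on `G`, the singular drift forces `u < 0` on the boundary of the
sector, contradicting positivity of `u`.  Here the drift integral is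
`D(t,x) = ∫∫_{0 ≤ s, |x-y| < t-s} u(s,y)^(-α) dy ds`. -/
theorem stmt0
    (α ε Y R δ t₀ x₀ : ℝ)
    (u G : ℝ → ℝ → ℝ)
    (hα : 3 < α) (hε0 : 0 < ε) (hε1 : ε < 1 / 2)
    (hexp : (3 - α) / 2 + ε * (α + 1) < 0)
    (hY : 0 < Y) (hR : 0 < R) (hδ : 0 < δ)
    (hbig : 1 < π * Y ^ (-1 - α) / 2 ^ (α + 2) * R ^ ((3 - α) / 2 + ε * (α + 1)))
    (hδY : δ < Y * R ^ (1 / 2 - ε))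
    (ht₀ : R ≤ t₀)
    (hu_meas : Measurable (Function.uncurry u))
    (hG_meas : Measurable (Function.uncurry G))
    -- (i) positivity of `u` on `[0, t₀] × ℝ`
    (hpos : ∀ s y : ℝ, 0 ≤ s → s ≤ t₀ → 0 < u s y)
    -- (ii) `u` hits level `δ` at `(t₀, x₀)`
    (hhit : u t₀ x₀ = δ)
    -- (iii) on the closed sector, the drift integral is finite and `u = G + D`
    (hmild : ∀ t x : ℝ, |x₀ - x| ≤ t₀ - t → (t₀ - t) ^ 2 + (x₀ - x) ^ 2 ≤ R ^ 2 →
      IntegrableOn (fun p : ℝ × ℝ => u p.1 p.2 ^ (-α))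
        {p : ℝ × ℝ | 0 ≤ p.1 ∧ |x - p.2| < t - p.1} volume ∧
      u t x = G t x +
        ∫ p in {p : ℝ × ℝ | 0 ≤ p.1 ∧ |x - p.2| < t - p.1}, u p.1 p.2 ^ (-α))
    -- (iv) Hölder-type bound for `G` centered at `(t₀, x₀)`
    (hHolder : ∀ t x : ℝ, |x₀ - x| ≤ t₀ - t → (t₀ - t) ^ 2 + (x₀ - x) ^ 2 ≤ R ^ 2 →
      |G t x - G t₀ x₀| ≤ Y * ((t₀ - t) ^ 2 + (x₀ - x) ^ 2) ^ ((1 / 2 - ε) / 2)) :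
    False := by
  have hα0 : 0 < α := by linarith
  set β := 1 / 2 - ε with hβ
  have hβ0 : 0 < β := by simp only [hβ]; linarith
  set L : ℝ × ℝ → Set (ℝ × ℝ) :=
    fun p => {q : ℝ × ℝ | 0 ≤ q.1 ∧ |p.2 - q.2| < p.1 - q.1} with hLdef
  set f : ℝ × ℝ → ℝ := fun p => u p.1 p.2 ^ (-α) with hf
  set S : Set (ℝ × ℝ) :=
    {p : ℝ × ℝ | |x₀ - p.2| < t₀ - p.1 ∧ (t₀ - p.1) ^ 2 + (x₀ - p.2) ^ 2 ≤ R ^ 2} with hSdef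
  set M := 2 * (Y * R ^ β) with hM
  have hRβ : 0 < R ^ β := Real.rpow_pos_of_pos hR β
  have hM0 : 0 < M := by positivity
  set c := M ^ (-α) with hc
  have hc0 : 0 < c := Real.rpow_pos_of_pos hM0 _
  -- measurability
  have hSm : MeasurableSet S :=
    (measurableSet_lt (f := fun p : ℝ × ℝ => |x₀ - p.2|) (g := fun p : ℝ × ℝ => t₀ - p.1)
        (by fun_prop) (by fun_prop)).inter
      (measurableSet_le (f := fun p : ℝ × ℝ => (t₀ - p.1) ^ 2 + (x₀ - p.2) ^ 2)
        (g := fun _ => R ^ 2) (by fun_prop) (by fun_prop))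
  have hLm : ∀ p, MeasurableSet (L p) := fun p =>
    (measurableSet_le (f := fun _ : ℝ × ℝ => (0:ℝ)) (g := fun q : ℝ × ℝ => q.1)
        (by fun_prop) (by fun_prop)).inter
      (measurableSet_lt (f := fun q : ℝ × ℝ => |p.2 - q.2|) (g := fun q : ℝ × ℝ => p.1 - q.1)
        (by fun_prop) (by fun_prop))
  have hTm : MeasurableSet {z : (ℝ × ℝ) × (ℝ × ℝ) | z.2 ∉ L z.1} := by
    apply MeasurableSet.compl
    exact (measurableSet_le (f := fun _ : (ℝ × ℝ) × (ℝ × ℝ) => (0:ℝ)) (g := fun q => q.2.1)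
        (by fun_prop) (by fun_prop)).inter
      (measurableSet_lt (f := fun q : (ℝ × ℝ) × (ℝ × ℝ) => |q.1.2 - q.2.2|)
        (g := fun q => q.1.1 - q.2.1) (by fun_prop) (by fun_prop))
  have hLanti : ∀ p q, q ∈ L p → p ∉ L q := by
    rintro p q ⟨_, h1⟩ ⟨_, h2⟩
    have := abs_nonneg (p.2 - q.2)
    have := abs_nonneg (q.2 - p.2)
    linarith
  have hR2 : ∀ p ∈ S, t₀ - p.1 ≤ R := by
    rintro p ⟨h1, h2⟩
    have := abs_nonneg (x₀ - p.2)
    nlinarith [sq_nonneg (x₀ - p.2)]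
  have hSL : S ⊆ L (t₀, x₀) := by
    intro p hp
    exact ⟨by linarith [hR2 p hp], hp.1⟩
  have hf0 : ∀ p ∈ L (t₀, x₀), 0 ≤ f p := by
    rintro p ⟨h1, h2⟩
    have := abs_nonneg (x₀ - p.2)
    simp only at h2
    exact (Real.rpow_pos_of_pos (hpos p.1 p.2 h1 (by linarith)) _).le
  obtain ⟨hI0, hD0⟩ := hmild t₀ x₀ (by simp) (by simp; positivity)
  change IntegrableOn f (L (t₀, x₀)) volume at hI0
  change u t₀ x₀ = G t₀ x₀ + ∫ p in L (t₀, x₀), f p at hD0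
  have hIS : IntegrableOn f S := hI0.mono_set hSL
  -- the key comparison
  have hkey : ∀ t x : ℝ, |x₀ - x| ≤ t₀ - t → (t₀ - t) ^ 2 + (x₀ - x) ^ 2 ≤ R ^ 2 →
      u t x ≤ M - ∫ q in S \ L (t, x), f q := by
    intro t x h1 h2
    obtain ⟨hI, hD⟩ := hmild t x h1 h2
    change IntegrableOn f (L (t, x)) volume at hI
    change u t x = G t x + ∫ p in L (t, x), f p at hD
    have hH := hHolder t x h1 h2
    have hsub : L (t, x) ∪ (S \ L (t, x)) ⊆ L (t₀, x₀) := by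
      apply Set.union_subset
      · rintro q ⟨h3, h4⟩
        refine ⟨h3, ?_⟩
        simp only at h4 ⊢
        have := abs_sub_le x₀ x q.2
        linarith
      · exact Set.sdiff_subset.trans hSL
    have hle : ∫ q in L (t, x) ∪ (S \ L (t, x)), f q ≤ ∫ q in L (t₀, x₀), f q := by
      apply setIntegral_mono_set hI0
      · exact (ae_restrict_iff' (hLm _)).2 (Filter.Eventually.of_forall hf0)
      · exact hsub.eventuallyLE
    rw [setIntegral_union Set.disjoint_sdiff_right (hSm.diff (hLm _)) hI
      (hIS.mono_set Set.sdiff_subset)] at hle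
    have hr : ((t₀ - t) ^ 2 + (x₀ - x) ^ 2) ^ (β / 2) ≤ R ^ β := by
      calc ((t₀ - t) ^ 2 + (x₀ - x) ^ 2) ^ (β / 2) ≤ (R ^ 2) ^ (β / 2) :=
            Real.rpow_le_rpow (by positivity) h2 (by positivity)
        _ = R ^ β := by
            rw [← Real.rpow_natCast, ← Real.rpow_mul hR.le]
            congr 1
            push_cast
            ring
    have hr' := mul_le_mul_of_nonneg_left hr hY.le
    have := (abs_le.1 (hH.trans hr')).2
    simp only [hM]
    linarith
  have hpS : ∀ p ∈ S, 0 < u p.1 p.2 := by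
    intro p hp
    have := abs_nonneg (x₀ - p.2)
    exact hpos _ _ (hSL hp).1 (by linarith [hp.1])
  have hSnn : ∀ A ⊆ S, MeasurableSet A → 0 ≤ ∫ q in A, f q := fun A hA hAm =>
    setIntegral_nonneg hAm fun q hq => hf0 q (hSL (hA hq))
  have hcf : ∀ p ∈ S, c ≤ f p := by
    intro p hp
    have h1 := hkey p.1 p.2 hp.1.le hp.2
    have h2 := hSnn (S \ L (p.1, p.2)) Set.sdiff_subset (hSm.diff (hLm _))
    exact Real.rpow_le_rpow_of_nonpos (hpS p hp) (by linarith) (by linarith)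
  -- finite volume of the sector
  have hSfin : volume S ≠ ⊤ := by
    have hsub : S ⊆ Set.Icc (t₀ - R) (t₀ + R) ×ˢ Set.Icc (x₀ - R) (x₀ + R) := by
      intro p hp
      have h1 : |t₀ - p.1| ≤ R :=
        abs_le_of_sq_le_sq (by nlinarith [hp.2, sq_nonneg (x₀ - p.2)]) hR.le
      have h2 : |x₀ - p.2| ≤ R :=
        abs_le_of_sq_le_sq (by nlinarith [hp.2, sq_nonneg (t₀ - p.1)]) hR.le
      rw [abs_le] at h1 h2
      exact ⟨⟨by linarith, by linarith⟩, ⟨by linarith, by linarith⟩⟩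
    exact ((measure_mono hsub).trans_lt
      (isCompact_Icc.prod isCompact_Icc).measure_lt_top).ne
  set m := volume.real S with hm
  have hmvol : π * R ^ 2 / 4 ≤ m := by
    have := aux_vol R t₀ x₀ hR
    exact (ENNReal.ofReal_le_iff_le_toReal hSfin).1 this
  have hpi := Real.pi_pos
  have hm0 : 0 < m := lt_of_lt_of_le (by positivity) hmvol
  -- the numerical hypothesis
  have hcm : M / 2 < c * m := by
    refine lt_of_lt_of_le ?_ (mul_le_mul_of_nonneg_left hmvol hc0.le)
    have e1 : c = (2 ^ α)⁻¹ * Y ^ (-α) * R ^ (-(α * β)) := by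
      rw [hc, hM, Real.mul_rpow (by norm_num) (by positivity), Real.mul_rpow hY.le hRβ.le,
        Real.rpow_neg (by norm_num), ← Real.rpow_mul hR.le, mul_assoc]
      congr 3
      ring
    have e2 : Y ^ (-1 - α) * Y = Y ^ (-α) := by
      rw [← Real.rpow_add_one hY.ne']
      congr 1
      ring
    have e3 : R ^ ((3 - α) / 2 + ε * (α + 1)) * R ^ β = R ^ (-(α * β)) * R ^ 2 := by
      rw [← Real.rpow_natCast R 2, ← Real.rpow_add hR, ← Real.rpow_add hR]
      congr 1
      simp only [hβ]
      push_cast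
      ring
    have e4 : (2:ℝ) ^ (α + 2) = 2 ^ α * 4 := by
      rw [Real.rpow_add (by norm_num)]
      norm_num
    have h2α : (0:ℝ) < 2 ^ α := by positivity
    have h := mul_lt_mul_of_pos_right hbig (by positivity : 0 < Y * R ^ β)
    have e5 : π * Y ^ (-1 - α) / 2 ^ (α + 2) * R ^ ((3 - α) / 2 + ε * (α + 1)) * (Y * R ^ β)
        = c * (π * R ^ 2 / 4) := by
      calc _ = π / 2 ^ (α + 2) * (Y ^ (-1 - α) * Y) *
            (R ^ ((3 - α) / 2 + ε * (α + 1)) * R ^ β) := by ring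
        _ = _ := by
            rw [e2, e3, e4, e1]
            field_simp
    rw [e5] at h
    simp only [hM]
    linarith
  -- pointwise lower bound for `f`
  set μ : Measure (ℝ × ℝ) := volume.restrict S with hμ
  haveI : IsFiniteMeasure μ := ⟨by
    rw [hμ, Measure.restrict_apply_univ]; exact lt_top_iff_ne_top.2 hSfin⟩
  have hμL : ∀ p, μ.real (L p)ᶜ = volume.real (S \ L p) := by
    intro p
    rw [measureReal_def, hμ, Measure.restrict_apply (hLm p).compl, measureReal_def,
      Set.inter_comm, Set.sdiff_eq]
  have hμu : μ.real Set.univ = m := by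
    rw [measureReal_def, hμ, Measure.restrict_apply_univ]; rfl
  have hlow : ∀ p ∈ S, c * (64 / 27) + c * (256 / 27) * (c / M * μ.real (L p)ᶜ - 1 / 4) ≤ f p := by
    intro p hp
    have h1 := hkey p.1 p.2 hp.1.le hp.2
    have h2 : c * volume.real (S \ L p) ≤ ∫ q in S \ L p, f q :=
      setIntegral_ge_of_const_le_real (hSm.diff (hLm _))
        (measure_ne_top_of_subset Set.sdiff_subset hSfin)
        (fun q hq => hcf q hq.1) (hIS.mono_set Set.sdiff_subset)
    have hup := hpS p hp
    set θ := c / M * μ.real (L p)ᶜ with hθ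
    have hθ0 : 0 ≤ θ := mul_nonneg (by positivity) measureReal_nonneg
    have h3 : u p.1 p.2 ≤ M * (1 - θ) := by
      have : M * (1 - θ) = M - c * volume.real (S \ L p) := by
        rw [hθ, hμL]
        field_simp
      rw [this]
      change u p.1 p.2 ≤ M - ∫ q in S \ L p, f q at h1
      linarith
    have h4 : 0 < 1 - θ := by
      by_contra hcon
      push Not at hcon
      nlinarith
    have h5 : (M * (1 - θ)) ^ (-α) ≤ f p :=
      Real.rpow_le_rpow_of_nonpos hup h3 (by linarith)
    rw [Real.mul_rpow hM0.le h4.le] at h5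
    have h6 := mul_le_mul_of_nonneg_left (aux_tangent α (1 - θ) hα h4 (by linarith)) hc0.le
    refine le_trans (le_trans (le_of_eq ?_) h6) h5
    ring
  obtain ⟨hθi, hθ⟩ := aux_double μ L hTm hLanti
  rw [hμu] at hθ
  have hFlow : c * (64 / 27) * m + c * (256 / 27) * (c / M * (∫ p, μ.real (L p)ᶜ ∂μ) - m / 4)
      ≤ ∫ p in S, f p := by
    have h1 : ∫ p, (c * (64 / 27) + c * (256 / 27) * (c / M * μ.real (L p)ᶜ - 1 / 4)) ∂μ
        ≤ ∫ p in S, f p := by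
      apply setIntegral_mono_on _ hIS hSm hlow
      exact (integrable_const _).add (((hθi.const_mul _).sub (integrable_const _)).const_mul _)
    refine le_trans (le_of_eq ?_) h1
    have hi2 : Integrable
        (fun p => c * (256 / 27) * (c / M * μ.real (L p)ᶜ - 1 / 4)) μ :=
      ((hθi.const_mul _).sub (integrable_const _)).const_mul _
    rw [integral_add (integrable_const _) hi2, integral_const_mul (c * (256 / 27)),
      integral_sub (hθi.const_mul _) (integrable_const _), integral_const_mul (c / M)]
    simp only [integral_const, hμu, smul_eq_mul]
    ring
  -- the bottom point of the sector
  have hbot := hkey (t₀ - R) x₀ (by simp; exact hR.le) (by simp)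
  have hSb : S \ L (t₀ - R, x₀) = S := by
    rw [sdiff_eq_left, Set.disjoint_left]
    rintro p hp ⟨_, h⟩
    have := abs_nonneg (x₀ - p.2)
    have := hR2 p hp
    simp only at h
    linarith
  rw [hSb] at hbot
  have hub := hpos (t₀ - R) x₀ (by linarith) (by linarith)
  have h7 : m / 4 ≤ c / M * (∫ p, μ.real (L p)ᶜ ∂μ) := by
    refine le_trans ?_ (mul_le_mul_of_nonneg_left hθ (by positivity))
    rw [div_mul_eq_mul_div, le_div_iff₀ hM0]
    nlinarith
  have h8 : 0 ≤ c * (256 / 27) * (c / M * (∫ p, μ.real (L p)ᶜ ∂μ) - m / 4) :=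
    mul_nonneg (by positivity) (by linarith)
  linarith
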